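/- Let g ≥ 3. Every Weierstrass spin chain at a vertex q₀ of the Weierstrass spin graph (the complete graph on Fin (g+1)) produces an even permutation of Fin g: its composite permutation has sign 1. -/

import Mathlib

theorem card_ne_fin (g : ℕ) (z : Fin (g+1)) :
    Fintype.card {w : Fin (g+1) // w ≠ z} = g := by
  simp [Fintype.card_subtype_compl]

/-- The unique order isomorphism `Fin g ≃o {w : Fin (g+1) // w ≠ z}`. -/
noncomputable def eIso (g : ℕ) (z : Fin (g+1)) : Fin g ≃o {w : Fin (g+1) // w ≠ z} :=
  Fintype.orderIsoFinOfCardEq _ (card_ne_fin g z)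

/-- Given a permutation `f` of `Fin (g+1)` with `f x = y`, the induced permutation
`e_y⁻¹ ∘ f ∘ e_x` of `Fin g` (junk value `1` if `f x ≠ y`). -/
noncomputable def spinPerm (g : ℕ) (f : Equiv.Perm (Fin (g+1))) (x y : Fin (g+1)) :
    Equiv.Perm (Fin g) :=
  if hf : f x = y then
    (eIso g x).toEquiv.trans
      ((f.subtypeEquiv (fun a =>
        not_congr (by rw [← hf]; exact f.injective.eq_iff.symm))).trans
        (eIso g y).toEquiv.symm)
  else 1

/-- One step of a Weierstrass spin chain: the oriented edge from `q` to `r` of the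
complete graph on `Fin (g+1)` together with the choice of the triangle `{q, r, s}`
containing it. -/
structure WStep (g : ℕ) where
  q : Fin (g+1)
  r : Fin (g+1)
  s : Fin (g+1)

namespace WStep

variable {g : ℕ}

/-- The step is valid if the three vertices of its triangle are pairwise distinct. -/
def valid (t : WStep g) : Prop := ([t.q, t.r, t.s] : List (Fin (g+1))).Nodup

/-- Source vertex of the step. -/
def src (t : WStep g) : Fin (g+1) := t.q

/-- Target vertex of the step. -/
def tgt (t : WStep g) : Fin (g+1) := t.r

/-- The spin permutation of the step: `σ^{{q,r,s}}_{qr} = e_r⁻¹ ∘ f ∘ e_q` for the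
3-cycle `f = (q r s)` of `Fin (g+1)`. -/
noncomputable def perm (t : WStep g) : Equiv.Perm (Fin g) :=
  spinPerm g ([t.q, t.r, t.s].formPerm) t.q t.r

end WStep

/-- `l` is a Weierstrass spin chain at the vertex `q₀`: a closed walk at `q₀` in the
complete graph on `Fin (g+1)` (encoded by its list of steps, consecutive steps matching)
together with a choice of a triangle along each edge. -/
def IsWChain (g : ℕ) (q₀ : Fin (g+1)) (l : List (WStep g)) : Prop :=
  (∀ t ∈ l, t.valid) ∧ List.Chain' (fun t u => t.tgt = u.src) l ∧
    (∀ t ∈ l.head?, t.src = q₀) ∧ (∀ t ∈ l.getLast?, t.tgt = q₀)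

/-- The permutation produced by a chain of steps `t₁, …, t_N`: the composite
`σ_{t_N} ∘ ⋯ ∘ σ_{t₁}`. -/
noncomputable def wChainPerm (g : ℕ) (l : List (WStep g)) : Equiv.Perm (Fin g) :=
  (l.map WStep.perm).reverse.prod

/-- The Weierstrass spin group at a vertex `q₀`: the set of permutations produced by all
Weierstrass spin chains at `q₀`. -/
noncomputable def wSpinGroupAt (g : ℕ) (q₀ : Fin (g+1)) : Set (Equiv.Perm (Fin g)) :=
  {σ | ∃ l : List (WStep g), IsWChain g q₀ l ∧ wChainPerm g l = σ}

theorem coe_eIso (g : ℕ) (z : Fin (g+1)) (j : Fin g) :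
    (eIso g z j : Fin (g+1)) = z.succAbove j := by
  have h : eIso g z = finSuccAboveOrderIso z := Subsingleton.elim _ _
  rw [h]
  rfl

theorem succAbove_spinPerm (g : ℕ) {f : Equiv.Perm (Fin (g+1))} {x y : Fin (g+1)}
    (hf : f x = y) (j : Fin g) :
    y.succAbove (spinPerm g f x y j) = f (x.succAbove j) := by
  rw [← coe_eIso, ← coe_eIso, spinPerm, dif_pos hf]
  simp

theorem sign_spinPerm (g : ℕ) {f : Equiv.Perm (Fin (g+1))} {x y : Fin (g+1)} (hf : f x = y) :
    Equiv.Perm.sign (spinPerm g f x y) =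
      (-1) ^ (x : ℕ) * (-1) ^ (y : ℕ) * Equiv.Perm.sign f := by
  have h : Equiv.Perm.decomposeFin.symm (0, spinPerm g f x y) =
      y.cycleRange * f * x.cycleRange⁻¹ := by
    ext j
    refine Fin.cases ?_ (fun j => ?_) j
    · simp [Equiv.Perm.inv_def, Fin.cycleRange_symm_zero, hf]
    · simp [Equiv.Perm.inv_def, Fin.cycleRange_symm_succ, ← succAbove_spinPerm g hf]
  have hs := congrArg Equiv.Perm.sign h
  rw [Equiv.Perm.decomposeFin.symm_sign] at hs
  simp only [if_true, one_mul, map_mul, Equiv.Perm.sign_inv, Fin.sign_cycleRange] at hs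
  rw [hs]
  ac_rfl

namespace WStep

theorem sign_perm {g : ℕ} {t : WStep g} (ht : t.valid) :
    Equiv.Perm.sign t.perm = (-1) ^ (t.src : ℕ) * (-1) ^ (t.tgt : ℕ) := by
  obtain ⟨q, r, s⟩ := t
  have hnd : [q, r, s].Nodup := ht
  have hf : [q, r, s].formPerm q = r := List.formPerm_apply_head q r [s] hnd
  have hc : ([q, r, s].formPerm).IsThreeCycle := by
    simp only [List.nodup_cons, List.mem_cons, List.not_mem_nil, or_false, not_or] at hnd
    have := Equiv.Perm.isThreeCycle_swap_mul_swap_same (Ne.symm hnd.1.1) hnd.2.1 hnd.1.2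
    simpa [List.formPerm_cons_cons, Equiv.swap_comm r q] using this
  simp only [perm, src, tgt]
  rw [sign_spinPerm g hf, hc.sign, mul_one]

end WStep

theorem sign_wChainPerm_cons {g : ℕ} (t : WStep g) (l : List (WStep g))
    (hv : ∀ u ∈ t :: l, u.valid) (hc : List.IsChain (fun t u => t.tgt = u.src) (t :: l)) :
    Equiv.Perm.sign (wChainPerm g (t :: l)) =
      (-1) ^ (t.src : ℕ) * (-1) ^ (((t :: l).getLast (List.cons_ne_nil t l)).tgt : ℕ) := by
  induction l generalizing t with
  | nil => simpa [wChainPerm] using WStep.sign_perm (hv t (by simp))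
  | cons u l ih =>
    rw [List.isChain_cons_cons] at hc
    have hu := ih u (fun w hw => hv w (List.mem_cons_of_mem t hw)) hc.2
    have hp : wChainPerm g (t :: u :: l) = wChainPerm g (u :: l) * t.perm := by
      simp [wChainPerm, mul_assoc]
    rw [hp, map_mul, hu, WStep.sign_perm (hv t (by simp)), hc.1,
      List.getLast_cons (List.cons_ne_nil u l), mul_comm, mul_assoc,
      ← mul_assoc ((-1) ^ (u.src : ℕ)), Int.units_mul_self, one_mul]

/-- For `g ≥ 3`, every Weierstrass spin chain at a vertex `q₀` of the Weierstrass spin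
graph (the complete graph on `Fin (g+1)`) produces an even permutation of `Fin g`. -/
theorem sign_wChainPerm_eq_one (g : ℕ) (hg : 3 ≤ g) (q₀ : Fin (g+1))
    (l : List (WStep g)) (hl : IsWChain g q₀ l) :
    Equiv.Perm.sign (wChainPerm g l) = 1 := by
  obtain ⟨hv, hc, hsrc, htgt⟩ := hl
  cases l with
  | nil => simp [wChainPerm]
  | cons t l =>
    rw [sign_wChainPerm_cons t l hv hc, hsrc t (by simp),
      htgt _ (List.getLast_mem_getLast? (List.cons_ne_nil t l)), Int.units_mul_self]
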